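/- Let p be a prime and let G be a finite non-abelian p-group. Suppose that every automorphism of G of order p that fixes the Frattini subgroup Φ(G) elementwise is an inner automorphism. Then d(Z(G/Z(G))) = d(Z(G)) · d(G), where Z(G/Z(G)), the center of the quotient G/Z(G), is canonically isomorphic to Z₂(G)/Z(G). -/

import Mathlib

/-- The subgroup of elements killed by the `p`-th power map. -/
abbrev powKer (p : ℕ) (A : Type*) [CommGroup A] : Subgroup A := (powMonoidHom p : A →* A).ker

section PGroupHoms

open scoped commutatorElement

theorem MonoidHom.apply_eq_one_of_mem_frattini {p : ℕ} [Fact p.Prime] {G : Type*} [Group G]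
    (f : G →* Multiplicative (ZMod p)) {x : G}
    (hx : x ∈ frattini G) : f x = 1 := by
  have hs : ∀ K : Subgroup (Multiplicative (ZMod p)), K = ⊥ ∨ K = ⊤ := fun K ↦
    have : Fact (Nat.card (Multiplicative (ZMod p))).Prime := ⟨by simpa using Fact.out⟩
    K.eq_bot_or_eq_top_of_prime_card
  rcases hs f.range with h | h
  · exact DFunLike.congr_fun (MonoidHom.range_eq_bot_iff.mp h) x
  · have hbot : IsCoatom (⊥ : Subgroup (Multiplicative (ZMod p))) :=
      ⟨bot_ne_top, fun K hK ↦ (hs K).resolve_left hK.ne'⟩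
    exact frattini_le_coatom
      (Subgroup.isCoatom_comap_of_surjective (MonoidHom.range_eq_top.mp h) hbot) hx

variable {p : ℕ} [Fact p.Prime] {G : Type*} [Group G] [Finite G]

/-- A proper subgroup of a finite `p`-group is killed by a nontrivial homomorphism to `ℤ/p`. -/
theorem IsPGroup.exists_hom_ne_one_of_ne_top (hG : IsPGroup p G) {H : Subgroup G} (hH : H ≠ ⊤) :
    ∃ f : G →* Multiplicative (ZMod p), f ≠ 1 ∧ ∀ x ∈ H, f x = 1 := by
  have hp : p.Prime := Fact.out
  obtain ⟨m, hm⟩ := IsPGroup.iff_card.mp hG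
  obtain ⟨n, hn⟩ := IsPGroup.iff_card.mp (hG.to_subgroup H)
  have hnm : n < m := by
    have hle : p ^ n ≤ p ^ m := by
      rw [← hn, ← hm]
      exact Subgroup.card_le_card_group H
    refine lt_of_le_of_ne ((Nat.pow_le_pow_iff_right hp.one_lt).mp hle) fun h ↦ hH ?_
    exact Subgroup.eq_top_of_card_eq H (by rw [hn, hm, h])
  obtain ⟨k, rfl⟩ : ∃ k, m = k + 1 := ⟨m - 1, by omega⟩
  obtain ⟨K, hK, hHK⟩ := Sylow.exists_subgroup_card_pow_prime_le p (n := n) (m := k)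
    (hm ▸ pow_dvd_pow p k.le_succ) H hn (by omega)
  have hidx : K.index = p := by
    have h := K.card_mul_index
    rw [hK, hm, pow_succ] at h
    exact Nat.eq_of_mul_eq_mul_left (pow_pos hp.pos k) h
  have : K.Normal := Subgroup.normal_of_index_eq_minFac_card <| by
    rw [hidx, hm, hp.pow_minFac k.succ_ne_zero]
  let e : G ⧸ K ≃* Multiplicative (ZMod p) :=
    mulEquivOfPrimeCardEq (p := p) (by rw [← Subgroup.index_eq_card, hidx]) (by simp)
  refine ⟨e.toMonoidHom.comp (QuotientGroup.mk' K), fun h ↦ ?_, fun x hx ↦ ?_⟩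
  · have hK' : K = ⊤ := by
      refine (Subgroup.eq_top_iff' K).mpr fun x ↦ ?_
      have hx := DFunLike.congr_fun h x
      simpa using hx
    rw [hK', Subgroup.index_top] at hidx
    exact hp.one_lt.ne hidx
  · simpa using hHK hx

/-- The Burnside basis theorem, in dual form. -/
theorem IsPGroup.finrank_hom_zmod (hG : IsPGroup p G) :
    Module.finrank (ZMod p) (Additive G →+ ZMod p) = Group.rank G := by
  classical
  have : Finite (Additive G →+ ZMod p) := DFunLike.finite _
  apply le_antisymm
  · obtain ⟨S, hS, hgen⟩ := Group.rank_spec G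
    let ev : (Additive G →+ ZMod p) →ₗ[ZMod p] (S → ZMod p) :=
      { toFun := fun φ s ↦ φ (Additive.ofMul s.1)
        map_add' := fun _ _ ↦ rfl
        map_smul' := fun _ _ ↦ rfl }
    have hev : Function.Injective ev := by
      intro φ ψ h
      have : AddMonoidHom.toMultiplicativeRight φ = AddMonoidHom.toMultiplicativeRight ψ :=
        MonoidHom.eq_of_eqOn_dense hgen fun s hs ↦ congrFun h ⟨s, hs⟩
      exact AddMonoidHom.toMultiplicativeRight.injective this
    have := LinearMap.finrank_le_finrank_of_injective hev
    rwa [Module.finrank_fintype_fun_eq_card, Fintype.card_coe, hS] at this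
  · let ev : G → Module.Dual (ZMod p) (Additive G →+ ZMod p) := fun g ↦
      { toFun := fun φ ↦ φ (Additive.ofMul g)
        map_add' := fun _ _ ↦ rfl
        map_smul' := fun _ _ ↦ rfl }
    obtain ⟨b, hb, hspan, -⟩ := Submodule.exists_fun_fin_finrank_span_eq (ZMod p) (Set.range ev)
    choose g hg using hb
    have hgen : Subgroup.closure (Set.range g) = ⊤ := by
      by_contra hne
      obtain ⟨f, hf, hker⟩ := hG.exists_hom_ne_one_of_ne_top hne
      refine hf (MonoidHom.ext fun x ↦ ?_)
      let φ : Additive G →+ ZMod p := MonoidHom.toAdditiveLeft f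
      have hmem : ev x ∈ Submodule.span (ZMod p) (Set.range b) :=
        hspan.ge (Submodule.subset_span ⟨x, rfl⟩)
      have hle : Submodule.span (ZMod p) (Set.range b) ≤
          LinearMap.ker (Module.Dual.eval (ZMod p) _ φ) := by
        rw [Submodule.span_le]
        rintro _ ⟨i, rfl⟩
        rw [← hg i]
        exact hker _ (Subgroup.subset_closure ⟨i, rfl⟩)
      exact hle hmem
    have hrank := Group.rank_le (S := Finset.univ.image g) (by simpa using hgen)
    calc Group.rank G ≤ (Finset.univ.image g).card := hrank
      _ ≤ _ := Finset.card_image_le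
      _ = Module.finrank (ZMod p) (Submodule.span (ZMod p) (Set.range ev)) := by simp
      _ ≤ Module.finrank (ZMod p) (Module.Dual (ZMod p) (Additive G →+ ZMod p)) :=
        Submodule.finrank_le _
      _ = _ := Subspace.dual_finrank_eq

theorem IsPGroup.card_hom_zmod (hG : IsPGroup p G) :
    Nat.card (Additive G →+ ZMod p) = p ^ Group.rank G := by
  have : Finite (Additive G →+ ZMod p) := DFunLike.finite _
  rw [Module.natCard_eq_pow_finrank (K := ZMod p), Nat.card_zmod, hG.finrank_hom_zmod]

theorem IsPGroup.card_hom_of_pow_eq_one (hG : IsPGroup p G) {A : Type*} [CommGroup A] [Finite A]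
    (hA : ∀ a : A, a ^ p = 1) : Nat.card (G →* A) = Nat.card A ^ Group.rank G := by
  let := AddCommGroup.zmodModule (n := p) (G := Additive A) hA
  have : Finite (Additive A) := ‹Finite A›
  let e := (Module.finBasis (ZMod p) (Additive A)).equivFun
  set k := Module.finrank (ZMod p) (Additive A)
  have hcard : Nat.card A = p ^ k := by
    have := Module.natCard_eq_pow_finrank (K := ZMod p) (V := Additive A)
    rwa [Nat.card_zmod] at this
  let E : (G →* A) ≃ (Fin k → (Additive G →+ ZMod p)) :=
    { toFun := fun f i ↦ ((Pi.evalAddMonoidHom _ i).comp e.toAddMonoidHom).comp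
        (MonoidHom.toAdditive f)
      invFun := fun F ↦ MonoidHom.toAdditive.symm
        (e.symm.toAddMonoidHom.comp (AddMonoidHom.mk' (fun x i ↦ F i x) (fun x y ↦ by
          ext i
          simp)))
      left_inv := fun f ↦ by
        ext x
        exact e.symm_apply_apply (Additive.ofMul (f x))
      right_inv := fun F ↦ by
        funext i
        ext x
        exact congrFun (e.apply_symm_apply (fun i ↦ F i x)) i }
  rw [Nat.card_congr E, Nat.card_fun, hG.card_hom_zmod, hcard]
  simp [← pow_mul, mul_comm]

theorem IsPGroup.card_ker_pow {A : Type*} [CommGroup A] [Finite A] (hA : IsPGroup p A) :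
    Nat.card (powKer p A) = p ^ Group.rank A := by
  set R := (powMonoidHom p : A →* A).range
  have hker : Nat.card (powMonoidHom p : A →* A).ker = Nat.card (A ⧸ R) := by
    have h1 := (powMonoidHom p : A →* A).ker.card_mul_index
    have h2 := R.card_mul_index
    rw [Subgroup.index_ker] at h1
    rw [← Subgroup.index_eq_card]
    rw [← h1, mul_comm] at h2
    exact (Nat.eq_of_mul_eq_mul_right Nat.card_pos h2).symm
  have hQ : ∀ q : A ⧸ R, q ^ p = 1 := by
    rintro ⟨a⟩
    exact (QuotientGroup.eq_one_iff _).mpr ⟨a, rfl⟩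
  let := AddCommGroup.zmodModule (n := p) (G := Additive (A ⧸ R)) hQ
  have : Finite (Additive (A ⧸ R)) := inferInstanceAs (Finite (A ⧸ R))
  have : Finite (Module.Dual (ZMod p) (Additive (A ⧸ R))) := Module.finite_of_finite (ZMod p)
  have hdual : Nat.card (A ⧸ R) = Nat.card (Module.Dual (ZMod p) (Additive (A ⧸ R))) := by
    rw [Module.natCard_eq_pow_finrank (K := ZMod p) (V := Module.Dual _ _),
      Subspace.dual_finrank_eq, ← Module.natCard_eq_pow_finrank (K := ZMod p)]
    rfl
  let E : (Additive (A ⧸ R) →+ ZMod p) ≃ (Additive A →+ ZMod p) :=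
    { toFun := fun φ ↦ φ.comp (MonoidHom.toAdditive (QuotientGroup.mk' R))
      invFun := fun ψ ↦ MonoidHom.toAdditiveLeft
        (QuotientGroup.lift R (AddMonoidHom.toMultiplicativeRight ψ) (by
          rintro _ ⟨a, rfl⟩
          change ψ (p • Additive.ofMul a) = 0
          simp))
      left_inv := fun φ ↦ by
        ext x
        rfl
      right_inv := fun ψ ↦ by
        ext x
        rfl }
  rw [hker, hdual, ← Nat.card_congr (AddMonoidHom.toZModLinearMapEquiv p).toEquiv, Nat.card_congr E,
    hA.card_hom_zmod]

/-- A finite nonabelian `p`-group has a central element of order `p` in its commutator subgroup. -/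
theorem IsPGroup.exists_mem_center_inf_commutator (hG : IsPGroup p G)
    (hna : ¬ ∀ a b : G, a * b = b * a) :
    ∃ u ∈ Subgroup.center G, orderOf u = p ∧ u ∈ commutator G := by
  have hnt : Nontrivial (G ⧸ Subgroup.center G) := by
    rw [← not_subsingleton_iff_nontrivial, QuotientGroup.subsingleton_iff]
    intro h
    refine hna fun a b ↦ ?_
    exact (Subgroup.mem_center_iff.mp (h ▸ Subgroup.mem_top b : b ∈ Subgroup.center G) a)
  have := (hG.to_quotient (Subgroup.center G)).center_nontrivial
  obtain ⟨⟨q, hq⟩, hq1⟩ := exists_ne (1 : Subgroup.center (G ⧸ Subgroup.center G))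
  obtain ⟨h, rfl⟩ := QuotientGroup.mk_surjective q
  have hh : h ∉ Subgroup.center G := fun hc ↦
    hq1 (Subtype.ext ((QuotientGroup.eq_one_iff h).mpr hc))
  obtain ⟨x, hx⟩ : ∃ x, x * h ≠ h * x := by
    simpa [Subgroup.mem_center_iff] using hh
  have hc : ⁅x, h⁆ ∈ Subgroup.center G := by
    rw [← QuotientGroup.eq_one_iff]
    have := Subgroup.mem_center_iff.mp hq (x : G ⧸ Subgroup.center G)
    change ⁅(x : G ⧸ Subgroup.center G), (h : G ⧸ Subgroup.center G)⁆ = 1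
    exact commutatorElement_eq_one_iff_mul_comm.mpr this
  have hc1 : ⁅x, h⁆ ≠ 1 := fun h1 ↦ hx (commutatorElement_eq_one_iff_mul_comm.mp h1)
  have hdvd : p ∣ orderOf ⁅x, h⁆ := by
    obtain ⟨n, hn⟩ := IsPGroup.iff_orderOf.mp hG ⁅x, h⁆
    rw [hn]
    refine dvd_pow_self p fun h0 ↦ hc1 ?_
    rwa [h0, pow_zero, orderOf_eq_one_iff] at hn
  refine ⟨⁅x, h⁆ ^ (orderOf ⁅x, h⁆ / p), pow_mem hc _, ?_, pow_mem ?_ _⟩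
  · exact orderOf_pow_orderOf_div (orderOf_pos _).ne' hdvd
  · exact Subgroup.commutator_mem_commutator (Subgroup.mem_top x) (Subgroup.mem_top h)

/-- `x ↦ x * f x`, for a homomorphism `f` to the center that vanishes on its own image, as an
automorphism. -/
def MonoidHom.centralAut {G : Type*} [Group G] (f : G →* Subgroup.center G)
    (hf : ∀ x, f (f x) = 1) : MulAut G where
  toFun x := x * f x
  invFun x := x * (f x)⁻¹
  left_inv x := by simp [hf]
  right_inv x := by simp [hf]
  map_mul' x y := by
    have := Subgroup.mem_center_iff.mp (f x).2 y
    simp only [map_mul, Subgroup.coe_mul]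
    rw [mul_assoc x y, ← mul_assoc y, this]
    simp only [mul_assoc]

theorem MonoidHom.centralAut_apply {G : Type*} [Group G] (f : G →* Subgroup.center G)
    (hf : ∀ x, f (f x) = 1) (x : G) : f.centralAut hf x = x * f x := rfl

theorem MonoidHom.centralAut_pow_apply {G : Type*} [Group G] (f : G →* Subgroup.center G)
    (hf : ∀ x, f (f x) = 1) (n : ℕ) (x : G) : (f.centralAut hf ^ n) x = x * (f x : G) ^ n := by
  induction n with
  | zero => simp
  | succ n ih =>
    rw [pow_succ', MulAut.mul_apply, ih, centralAut_apply, map_mul, map_pow, hf]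
    simp [pow_succ, mul_assoc]

theorem MonoidHom.orderOf_centralAut {G : Type*} [Group G] (f : G →* Subgroup.center G)
    (hf : ∀ x, f (f x) = 1) (hfp : ∀ x, f x ^ p = 1) (hne : f ≠ 1) :
    orderOf (f.centralAut hf) = p := by
  refine orderOf_eq_prime (MulEquiv.ext fun x ↦ ?_) fun h ↦ hne (MonoidHom.ext fun x ↦ ?_)
  · rw [centralAut_pow_apply, ← Subgroup.coe_pow, hfp]
    simp
  · have hx := DFunLike.congr_fun h x
    rw [centralAut_apply] at hx
    simpa using hx

theorem mul_pow_of_mul_eq {G : Type*} [Group G] {x h c : G} (hc : c ∈ Subgroup.center G)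
    (hxh : x * h = h * (x * c)) (n : ℕ) : x * h ^ n = h ^ n * (x * c ^ n) := by
  induction n with
  | zero => simp
  | succ n ih =>
    have hcn := Subgroup.mem_center_iff.mp (pow_mem hc n) h
    calc x * h ^ (n + 1) = h ^ n * x * (c ^ n * h) := by rw [pow_succ, ← mul_assoc, ih]; group
      _ = h ^ n * (x * h) * c ^ n := by rw [← hcn]; group
      _ = h ^ (n + 1) * (x * c ^ (n + 1)) := by rw [hxh]; group

/-- A separation principle for groups of exponent `p`. -/
theorem CommGroup.eq_one_of_forall_hom_zmod {A : Type*} [CommGroup A] (hA : ∀ a : A, a ^ p = 1)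
    {a : A} (h : ∀ f : A →* Multiplicative (ZMod p), f a = 1) : a = 1 := by
  let := AddCommGroup.zmodModule (n := p) (G := Additive A) hA
  have h0 : Additive.ofMul a = 0 :=
    (Module.forall_dual_apply_eq_zero_iff (ZMod p) (Additive.ofMul a)).mp fun φ ↦
      h (AddMonoidHom.toMultiplicativeRight φ.toAddMonoidHom)
  exact h0

/-- The homomorphism from `ℤ/p` sending the generator `1` to an element `u` with `u ^ p = 1`. -/
def zmodPowHom {A : Type*} [Group A] (u : A) (hu : u ^ p = 1) : Multiplicative (ZMod p) →* A where
  toFun x := u ^ (Multiplicative.toAdd x).val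
  map_one' := by simp
  map_mul' x y := by
    rw [toAdd_mul, ZMod.val_add, ← pow_add]
    exact (pow_eq_pow_mod _ hu).symm

end PGroupHoms

section CenterHoms

open scoped IsMulCommutative

/-- If order-`p` automorphisms fixing the Frattini subgroup are inner, then every homomorphism to
the center with values of exponent `p` is given by commutation with some element. -/
theorem exists_conj_eq_mul_hom_center {p : ℕ} [Fact p.Prime] {G : Type*} [Group G]
    (hinner : ∀ α : MulAut G, orderOf α = p → (∀ x ∈ frattini G, α x = x) →
      ∃ h : G, ∀ x : G, α x = h⁻¹ * x * h)
    (f : G →* powKer p (Subgroup.center G))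
    (hf : ∀ x, f ((f x : Subgroup.center G) : G) = 1) :
    ∃ h : G, ∀ x : G, x * ((f x : Subgroup.center G) : G) = h⁻¹ * x * h := by
  by_cases hne : f = 1
  · exact ⟨1, by simp [hne]⟩
  let f' : G →* Subgroup.center G := (Subgroup.subtype _).comp f
  have hf' : ∀ x, f' (f' x) = 1 := fun x ↦ congrArg Subtype.val (hf x)
  have hfp : ∀ x, f' x ^ p = 1 := fun x ↦ (f x).2
  refine hinner (f'.centralAut hf') (f'.orderOf_centralAut hf' hfp fun h ↦ hne ?_) ?_
  · ext x
    exact congrArg Subtype.val (DFunLike.congr_fun h x)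
  · intro x hx
    have hx1 : f x = 1 :=
      CommGroup.eq_one_of_forall_hom_zmod (p := p) (fun a ↦ Subtype.ext a.2) fun φ ↦
        (φ.comp f).apply_eq_one_of_mem_frattini hx
    simp [MonoidHom.centralAut_apply, f', hx1]

/-- If order-`p` automorphisms fixing the Frattini subgroup are inner, then the center is killed by
every homomorphism to `ℤ/p`, i.e. it is contained in the Frattini subgroup. -/
theorem IsPGroup.hom_zmod_apply_eq_one_of_mem_center {p : ℕ} [Fact p.Prime] {G : Type*} [Group G]
    [Finite G] (hpG : IsPGroup p G) (hna : ¬ ∀ a b : G, a * b = b * a)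
    (hinner : ∀ α : MulAut G, orderOf α = p → (∀ x ∈ frattini G, α x = x) →
      ∃ h : G, ∀ x : G, α x = h⁻¹ * x * h)
    (φ : G →* Multiplicative (ZMod p)) {z : G} (hz : z ∈ Subgroup.center G) : φ z = 1 := by
  obtain ⟨u, huZ, hu, huc⟩ := hpG.exists_mem_center_inf_commutator hna
  have hup : u ^ p = 1 := hu ▸ pow_orderOf_eq_one u
  let w : powKer p (Subgroup.center G) :=
    ⟨⟨u, huZ⟩, Subtype.ext hup⟩
  have hw : w ^ p = 1 := Subtype.ext (Subtype.ext hup)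
  have hφu : φ u = 1 := Abelianization.commutator_subset_ker φ huc
  obtain ⟨h, hh⟩ := exists_conj_eq_mul_hom_center hinner ((zmodPowHom w hw).comp φ) fun x ↦ by
    have : φ (u ^ (Multiplicative.toAdd (φ x)).val) = 1 := by rw [map_pow, hφu, one_pow]
    exact (congrArg (zmodPowHom w hw) this).trans (map_one _)
  have hz' : h⁻¹ * z * h = z := by
    rw [mul_assoc, ← Subgroup.mem_center_iff.mp hz h, inv_mul_cancel_left]
  have hpow : u ^ (Multiplicative.toAdd (φ z)).val = 1 :=
    mul_eq_left.mp ((hh z).trans hz')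
  have hdvd := orderOf_dvd_of_pow_eq_one hpow
  rw [hu] at hdvd
  exact (ZMod.val_eq_zero _).mp (Nat.eq_zero_of_dvd_of_lt hdvd (ZMod.val_lt _))

/-- Commutation with an element that is central modulo the center. -/
def commutatorHom {G : Type*} [Group G] (h : G)
    (hh : ∀ x : G, x⁻¹ * h⁻¹ * x * h ∈ Subgroup.center G) : G →* Subgroup.center G :=
  MonoidHom.mk' (fun x ↦ ⟨x⁻¹ * h⁻¹ * x * h, hh x⟩) fun x y ↦ Subtype.ext <| by
    have hc := Subgroup.mem_center_iff.mp (hh x) y⁻¹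
    calc (x * y)⁻¹ * h⁻¹ * (x * y) * h
        = y⁻¹ * (x⁻¹ * h⁻¹ * x * h) * (h⁻¹ * y * h) := by group
      _ = (x⁻¹ * h⁻¹ * x * h) * (y⁻¹ * h⁻¹ * y * h) := by rw [hc]; group

/-- If every homomorphism to the center with values of exponent `p` is given by commutation with
some element, then these homomorphisms correspond to the elements of exponent `p` in the second
center modulo the center. -/
theorem card_hom_ker_pow_center {p : ℕ} {G : Type*} [Group G]
    (H : ∀ f : G →* powKer p (Subgroup.center G),
      ∃ h : G, ∀ x : G, x * ((f x : Subgroup.center G) : G) = h⁻¹ * x * h) :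
    Nat.card (G →* powKer p (Subgroup.center G)) =
      Nat.card (powKer p (Subgroup.center (G ⧸ Subgroup.center G))) := by
  choose h hh using H
  have hcomm : ∀ f x, x * h f = h f * (x * ((f x : Subgroup.center G) : G)) := fun f x ↦ by
    rw [hh f x]
    group
  have hcentral : ∀ f, (h f : G ⧸ Subgroup.center G) ∈ Subgroup.center (G ⧸ Subgroup.center G) := by
    intro f
    rw [Subgroup.mem_center_iff]
    rintro ⟨x⟩
    change ((x * h f : G) : G ⧸ Subgroup.center G) = ((h f * x : G) : G ⧸ Subgroup.center G)
    rw [hcomm, ← mul_assoc, QuotientGroup.mk_mul_of_mem _ (f x : Subgroup.center G).2]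
  have hpow : ∀ f, h f ^ p ∈ Subgroup.center G := fun f ↦ by
    refine Subgroup.mem_center_iff.mpr fun x ↦ ?_
    have hfp : ((f x : Subgroup.center G) : G) ^ p = 1 := congrArg Subtype.val (f x).2
    rw [mul_pow_of_mul_eq (f x : Subgroup.center G).2 (hcomm f x), hfp, mul_one]
  refine Nat.card_congr (Equiv.ofBijective (fun f ↦ ⟨⟨h f, hcentral f⟩,
    Subtype.ext ((QuotientGroup.eq_one_iff _).mpr (hpow f))⟩) ⟨fun f g hfg ↦ ?_, ?_⟩)
  · have hmem : (h f)⁻¹ * h g ∈ Subgroup.center G :=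
      QuotientGroup.eq.mp (congrArg (fun q ↦ q.1.1) hfg)
    ext x
    have hx := Subgroup.mem_center_iff.mp hmem ((h f)⁻¹ * x * h f)
    refine mul_left_cancel (a := x) ?_
    rw [hh f x, hh g x]
    refine mul_left_cancel (a := (h f)⁻¹ * h g) ?_
    rw [← hx]
    group
  · rintro ⟨⟨q, hq⟩, hqp⟩
    obtain ⟨k, rfl⟩ := QuotientGroup.mk_surjective q
    have hk : ∀ x : G, x⁻¹ * k⁻¹ * x * k ∈ Subgroup.center G := fun x ↦ by
      have hx := Subgroup.mem_center_iff.mp hq (x : G ⧸ Subgroup.center G)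
      have := QuotientGroup.eq.mp (hx.symm : ((k * x : G) : G ⧸ Subgroup.center G) = (x * k : G))
      simpa [mul_assoc] using this
    have hkp : k ^ p ∈ Subgroup.center G :=
      (QuotientGroup.eq_one_iff _).mp (congrArg Subtype.val hqp)
    have hker : ∀ x, commutatorHom k hk x ∈ powKer p (Subgroup.center G) := fun x ↦ by
      refine Subtype.ext ?_
      change (x⁻¹ * k⁻¹ * x * k) ^ p = 1
      have h1 := mul_pow_of_mul_eq (x := x) (h := k) (hk x) (by group) p
      rw [Subgroup.mem_center_iff.mp hkp x] at h1
      exact mul_eq_left.mp (mul_left_cancel h1).symm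
    let f := (commutatorHom k hk).codRestrict _ hker
    refine ⟨f, Subtype.ext (Subtype.ext (QuotientGroup.eq.mpr ?_))⟩
    refine Subgroup.mem_center_iff.mpr fun x ↦ ?_
    have hx : (k * x * k⁻¹) * ((k * x * k⁻¹)⁻¹ * k⁻¹ * (k * x * k⁻¹) * k) =
      (h f)⁻¹ * (k * x * k⁻¹) * h f := hh f (k * x * k⁻¹)
    have hx' : x = (h f)⁻¹ * (k * x * k⁻¹) * h f := by
      rw [← hx]
      group
    calc x * ((h f)⁻¹ * k) = ((h f)⁻¹ * (k * x * k⁻¹) * h f) * ((h f)⁻¹ * k) := by rw [← hx']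
      _ = (h f)⁻¹ * k * x := by group

theorem IsPGroup.rank_center_quotient_center {p : ℕ} [Fact p.Prime] {G : Type*} [Group G] [Finite G]
    (hpG : IsPGroup p G) (hna : ¬ ∀ a b : G, a * b = b * a)
    (hinner : ∀ α : MulAut G, orderOf α = p → (∀ x ∈ frattini G, α x = x) →
      ∃ h : G, ∀ x : G, α x = h⁻¹ * x * h) :
    Group.rank (Subgroup.center (G ⧸ Subgroup.center G)) =
      Group.rank (Subgroup.center G) * Group.rank G := by
  set W := powKer p (Subgroup.center G)
  have hW : ∀ a : W, a ^ p = 1 := fun a ↦ Subtype.ext a.2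
  have hcard := card_hom_ker_pow_center (p := p) (G := G) fun f ↦
    exists_conj_eq_mul_hom_center hinner f fun x ↦
      CommGroup.eq_one_of_forall_hom_zmod (p := p) hW fun φ ↦
        hpG.hom_zmod_apply_eq_one_of_mem_center hna hinner (φ.comp f) (f x : Subgroup.center G).2
  rw [hpG.card_hom_of_pow_eq_one hW, (hpG.to_subgroup _).card_ker_pow, ← pow_mul,
    ((hpG.to_quotient _).to_subgroup _).card_ker_pow] at hcard
  exact (Nat.pow_right_injective (Fact.out : p.Prime).two_le hcard).symm

end CenterHoms

/-- If every order-`p` automorphism of a finite non-abelian `p`-group `G`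
fixing `Φ(G)` elementwise is inner, then
`d(Z(G/Z(G))) = d(Z(G)) * d(G)`. -/
theorem stmt3 {p : ℕ} (hp : p.Prime) (G : Type*) [Group G] [Finite G]
    (hpG : IsPGroup p G) (hna : ¬ ∀ a b : G, a * b = b * a)
    (hinner : ∀ α : MulAut G, orderOf α = p → (∀ x ∈ frattini G, α x = x) →
      ∃ h : G, ∀ x : G, α x = h⁻¹ * x * h) :
    Group.rank (Subgroup.center (G ⧸ Subgroup.center G)) =
      Group.rank (Subgroup.center G) * Group.rank G := by
  have : Fact p.Prime := ⟨hp⟩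
  exact hpG.rank_center_quotient_center hna hinner
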